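/- Tree-indexed product differentiation rule (formula (3.5) of Lemma 3.6, in its directional form): Let N ≥ 1, let f, g : ℝ^m → ℝ be N times continuously differentiable and let F : ℝ → ℝ^m be N times continuously differentiable. Then for every t ∈ ℝ, the N-th derivative of t ↦ f(F(t))·g(F(t)) equals M_1(N) + M_2(N), where M_1(N) = ∑_{i ∈ A_N} g(F(t)) · ∂^{ℓ_1^i} f(F(t))[F^{(ℓ_2^i)}(t), …, F^{(ℓ_{α_i}^i)}(t)], and M_2(N) = ∑_{i ∈ A_N} ∑_{r=2}^{α_i} ( (g ∘ F)^{(ℓ_r^i)}(t) ) · ∂^{ℓ_1^i − 1} f(F(t))[F^{(ℓ_2^i)}(t), …, F^{(ℓ_{r−1}^i)}(t), F^{(ℓ_{r+1}^i)}(t), …, F^{(ℓ_{α_i}^i)}(t)], i.e. in the r-th term of M_2(N) the vector argument F^{(ℓ_r^i)}(t) is removed and the remaining α_i − 2 = ℓ_1^i − 1 vectors are the arguments of ∂^{ℓ_1^i − 1} f(F(t)), the whole being multiplied by the scalar ℓ_r^i-th derivative of g ∘ F at t. -/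

import Mathlib

/-- A branch of length `N`: a sequence `i_1, …, i_N` of positive integers (encoded as a
function `ℕ → ℕ` vanishing outside `{1, …, N}`) such that `i_1 = 1` and, for every
`1 ≤ τ < N`, `i_{τ+1} ≤ 1 + #{σ ∈ {1,…,τ} : i_σ = 1}`.  `A_N` is the set of branches of
length `N`. -/
def IsBranch (N : ℕ) (i : ℕ → ℕ) : Prop :=
  i 1 = 1 ∧
  (∀ τ, 1 ≤ τ → τ ≤ N → 1 ≤ i τ) ∧
  (∀ τ, 1 ≤ τ → τ < N →
    i (τ + 1) ≤ 1 + ((Finset.Icc 1 τ).filter (fun σ => i σ = 1)).card) ∧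
  (∀ τ, τ = 0 ∨ N < τ → i τ = 0)

/-- `ell N i r = ℓ_r^i`: for `r = 1` the number of `1`'s in the branch `i` of length `N`,
and for `r ≥ 2` one plus the number of `r`'s in `i`. -/
def ell (N : ℕ) (i : ℕ → ℕ) (r : ℕ) : ℕ :=
  if r = 1 then ((Finset.Icc 1 N).filter (fun τ => i τ = 1)).card
  else 1 + ((Finset.Icc 1 N).filter (fun τ => i τ = r)).card

/-- `alpha N i = α_i = ℓ_1^i + 1`. -/
def alpha (N : ℕ) (i : ℕ → ℕ) : ℕ := ell N i 1 + 1

section Analysis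

variable {E : Type*} [NormedAddCommGroup E] [NormedSpace ℝ E]

/-- Iterated derivatives commute with directional derivatives. -/
theorem iteratedFDeriv_fderiv_apply_const {h : E → ℝ} (k : ℕ) (hh : ContDiff ℝ (k + 1 : ℕ) h)
    (x v : E) (w : Fin k → E) :
    iteratedFDeriv ℝ k (fun y => fderiv ℝ h y v) x w =
      fderiv ℝ (fun y => iteratedFDeriv ℝ k h y w) x v := by
  induction k generalizing x with
  | zero => simp
  | succ k ih =>
    have hk : ContDiff ℝ (k + 1 : ℕ) h := hh.of_le (by norm_cast; omega)
    have hD : ContDiff ℝ (k + 1 : ℕ) (fun y => fderiv ℝ h y v) :=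
      (hh.fderiv_right (m := (k + 1 : ℕ)) (by norm_cast)).clm_apply contDiff_const
    have hd : Differentiable ℝ (iteratedFDeriv ℝ k fun y => fderiv ℝ h y v) :=
      hD.differentiable_iteratedFDeriv (by norm_cast; omega)
    have hd' : Differentiable ℝ (iteratedFDeriv ℝ k h) :=
      hk.differentiable_iteratedFDeriv (by norm_cast; omega)
    have h2 : ContDiff ℝ (2 : ℕ) (iteratedFDeriv ℝ k h) :=
      hh.iteratedFDeriv_right (by norm_cast; omega)
    have hφ : ContDiff ℝ (2 : ℕ) (fun y => iteratedFDeriv ℝ k h y (Fin.tail w)) :=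
      (ContinuousMultilinearMap.apply ℝ (fun _ : Fin k => E) ℝ (Fin.tail w)).contDiff.comp h2
    have hsymm := hφ.contDiffAt.isSymmSndFDerivAt (x := x) (by simp)
    have hfd : DifferentiableAt ℝ
        (fderiv ℝ (fun y => iteratedFDeriv ℝ k h y (Fin.tail w))) x :=
      (hφ.fderiv_right (m := 1) (by norm_num)).differentiable (by norm_num) x
    rw [DifferentiableAt.iteratedFDeriv_succ_apply_left' hd.differentiableAt]
    simp_rw [DifferentiableAt.iteratedFDeriv_succ_apply_left' hd'.differentiableAt, ih hk]
    rw [fderiv_clm_apply hfd (by fun_prop), fderiv_clm_apply hfd (by fun_prop)]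
    simpa using hsymm (w 0) v

/-- The vector of the outermost derivative may be put in the last slot. -/
theorem fderiv_iteratedFDeriv_apply_eq_snoc {h : E → ℝ} (k : ℕ)
    (hh : ContDiff ℝ (k + 1 : ℕ) h) (x v : E) (w : Fin k → E) :
    fderiv ℝ (iteratedFDeriv ℝ k h) x v w =
      iteratedFDeriv ℝ (k + 1) h x (Fin.snoc (α := fun _ => E) w v) := by
  have hd : Differentiable ℝ (iteratedFDeriv ℝ k h) :=
    hh.differentiable_iteratedFDeriv (by norm_cast; omega)
  rw [iteratedFDeriv_succ_apply_right, Fin.init_snoc, Fin.snoc_last,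
    ← iteratedFDeriv_clm_apply_const_apply (n := k) (hh.fderiv_right (by norm_cast)) le_rfl,
    iteratedFDeriv_fderiv_apply_const k hh,
    fderiv_continuousMultilinear_apply_const_apply hd.differentiableAt]

theorem hasDerivAt_iteratedFDeriv_iteratedDeriv {h : E → ℝ} {H : ℝ → E} {k n : ℕ} (a : ℕ → ℕ)
    (hh : ContDiff ℝ (k + 1 : ℕ) h) (hH : ContDiff ℝ n H) (hn : 1 ≤ n)
    (ha : ∀ j < k, a j < n) (s : ℝ) :
    HasDerivAt (fun s => iteratedFDeriv ℝ k h (H s) (fun j : Fin k => iteratedDeriv (a j) H s))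
      (∑ q ∈ Finset.range k, iteratedFDeriv ℝ k h (H s)
          (fun j : Fin k => iteratedDeriv (a j + if (j : ℕ) = q then 1 else 0) H s) +
        iteratedFDeriv ℝ (k + 1) h (H s)
          (fun j : Fin (k + 1) => iteratedDeriv (if (j : ℕ) = k then 1 else a j) H s)) s := by
  have hdh : Differentiable ℝ (iteratedFDeriv ℝ k h) :=
    hh.differentiable_iteratedFDeriv (by norm_cast; omega)
  have hdH : HasDerivAt H (iteratedDeriv 1 H s) s := by
    rw [iteratedDeriv_one]
    exact (hH.differentiable (by norm_cast; omega) s).hasDerivAt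
  have hda (j : Fin k) :
      HasDerivAt (iteratedDeriv (a j) H) (iteratedDeriv (a j + 1) H s) s := by
    rw [iteratedDeriv_succ]
    exact (hH.differentiable_iteratedDeriv _ (by exact_mod_cast ha j j.2) s).hasDerivAt
  have key := ((hdh (H s)).hasFDerivAt.comp s hdH.hasFDerivAt).continuousMultilinearMap_apply
    (fun j => (hda j).hasFDerivAt)
  refine key.hasDerivAt.congr_deriv ?_
  have hsnoc : (fun j : Fin (k + 1) => iteratedDeriv (if (j : ℕ) = k then 1 else a j) H s) =
      Fin.snoc (α := fun _ => E) (fun j : Fin k => iteratedDeriv (a j) H s)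
        (iteratedDeriv 1 H s) := by
    ext j
    refine Fin.lastCases ?_ (fun j => ?_) j
    · simp
    · simp [j.2.ne]
  rw [hsnoc, ← fderiv_iteratedFDeriv_apply_eq_snoc k hh, add_comm, Finset.sum_range]
  simp only [Function.comp_apply, add_apply, ContinuousLinearMap.coe_comp,
    ContinuousMultilinearMap.apply_apply, sum_apply,
    ContinuousLinearMap.toSpanSingleton_apply, one_smul]
  congr 1
  · refine Finset.sum_congr rfl fun q _ => ?_
    simp only [ContinuousMultilinearMap.toContinuousLinearMap_apply]
    congr 1
    ext j
    by_cases hj : j = q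
    · subst hj; simp
    · have : (j : ℕ) ≠ q := fun e => hj (Fin.ext e)
      simp [hj, this]

theorem iteratedFDeriv_fst_mul_snd {f : E → ℝ} (k : ℕ) (hf : ContDiff ℝ (k + 1 : ℕ) f)
    (z : E × ℝ) (p : Fin (k + 1) → E × ℝ) :
    iteratedFDeriv ℝ (k + 1) (fun z : E × ℝ => f z.1 * z.2) z p =
      z.2 * iteratedFDeriv ℝ (k + 1) f z.1 (fun j => (p j).1) +
        ∑ r, (p r).2 * iteratedFDeriv ℝ k f z.1 (fun j => (p (r.succAbove j)).1) := by
  induction k generalizing z with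
  | zero =>
    have hd : HasFDerivAt f (fderiv ℝ f z.1) z.1 :=
      (hf.differentiable (by norm_num) _).hasFDerivAt
    have := (hd.comp z (hasFDerivAt_fst (𝕜 := ℝ) (p := z))).mul (hasFDerivAt_snd (𝕜 := ℝ) (p := z))
    erw [iteratedFDeriv_one_apply, iteratedFDeriv_one_apply, this.fderiv]
    simp
    ring
  | succ k ih =>
    have hk : ContDiff ℝ (k + 1 : ℕ) f := hf.of_le (by norm_cast; omega)
    have hprod : ContDiff ℝ (k + 1 + 1 : ℕ) (fun z : E × ℝ => f z.1 * z.2) :=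
      (hf.comp contDiff_fst).mul contDiff_snd
    have hd : Differentiable ℝ (iteratedFDeriv ℝ (k + 1) fun z : E × ℝ => f z.1 * z.2) :=
      hprod.differentiable_iteratedFDeriv (by norm_cast; omega)
    have hc (l : ℕ) (hl : l < k + 2) (w : Fin l → E) :
        HasFDerivAt (fun z : E × ℝ => iteratedFDeriv ℝ l f z.1 w)
          ((ContinuousMultilinearMap.apply ℝ (fun _ : Fin l => E) ℝ w ∘L
            fderiv ℝ (iteratedFDeriv ℝ l f) z.1) ∘L ContinuousLinearMap.fst ℝ E ℝ) z := by
      have := (hf.differentiable_iteratedFDeriv (m := l) (by exact_mod_cast hl) z.1).hasFDerivAt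
      exact ((ContinuousMultilinearMap.apply ℝ (fun _ : Fin l => E) ℝ w).hasFDerivAt.comp z.1
        this).comp z hasFDerivAt_fst
    rw [DifferentiableAt.iteratedFDeriv_succ_apply_left' hd.differentiableAt]
    simp_rw [ih hk]
    have h1 := (hasFDerivAt_snd (𝕜 := ℝ) (p := z)).mul
      (hc (k + 1) (by omega) (fun j => (Fin.tail p j).1))
    have h2 := HasFDerivAt.fun_sum (u := Finset.univ) fun (r : Fin (k + 1)) _ =>
      (hc k (by omega) (fun j => (Fin.tail p (r.succAbove j)).1)).const_mul (Fin.tail p r).2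
    erw [(h1.add h2).fderiv]
    conv_rhs => rw [Fin.sum_univ_succ]
    simp only [add_apply, smul_apply, ContinuousLinearMap.coe_comp, Function.comp_apply,
      ContinuousMultilinearMap.apply_apply, sum_apply, smul_eq_mul,
      ContinuousLinearMap.coe_fst', ContinuousLinearMap.coe_snd',
      iteratedFDeriv_succ_apply_left, Fin.succAbove_zero, Fin.succ_succAbove_zero, Fin.tail_def,
      Fin.succ_succAbove_succ]
    ring

end Analysis

section Branches

open Finset Function

theorem ell_one (n : ℕ) (i : ℕ → ℕ) : ell n i 1 = #{τ ∈ Icc 1 n | i τ = 1} := by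
  simp [ell]

theorem ell_update (n : ℕ) (i : ℕ → ℕ) (c r : ℕ) :
    ell (n + 1) (update i (n + 1) c) r = ell n i r + if c = r then 1 else 0 := by
  have key (r : ℕ) : #{τ ∈ Icc 1 (n + 1) | update i (n + 1) c τ = r} =
      #{τ ∈ Icc 1 n | i τ = r} + if c = r then 1 else 0 := by
    rw [← insert_Icc_right_eq_Icc_add_one (by omega), filter_insert]
    have : {τ ∈ Icc 1 n | update i (n + 1) c τ = r} = {τ ∈ Icc 1 n | i τ = r} := by
      refine filter_congr fun τ hτ => ?_
      rw [update_of_ne (by have := mem_Icc.1 hτ; omega)]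
    rw [this, update_self]
    split_ifs
    · rw [card_insert_of_notMem (by simp)]
    · rfl
  simp only [ell, key]
  by_cases hr : r = 1
  · simp [hr]
  · simp [hr, add_assoc]

theorem ell_congr {n : ℕ} {i i' : ℕ → ℕ} (h : ∀ τ ≤ n, i τ = i' τ) (r : ℕ) :
    ell n i r = ell n i' r := by
  have : {τ ∈ Icc 1 n | i τ = r} = {τ ∈ Icc 1 n | i' τ = r} :=
    filter_congr fun τ hτ => by rw [h τ (mem_Icc.1 hτ).2]
  have h1 : {τ ∈ Icc 1 n | i τ = 1} = {τ ∈ Icc 1 n | i' τ = 1} :=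
    filter_congr fun τ hτ => by rw [h τ (mem_Icc.1 hτ).2]
  rw [ell, ell, this, h1]

theorem ell_one_mono {n n' : ℕ} (h : n ≤ n') (i : ℕ → ℕ) : ell n i 1 ≤ ell n' i 1 := by
  rw [ell_one, ell_one]
  gcongr

theorem ell_one_le (n : ℕ) (i : ℕ → ℕ) : ell n i 1 ≤ n := by
  rw [ell_one]
  exact (card_filter_le _ _).trans (by simp)

open Classical in
/-- The set of branches of length `n`, built by appending one entry at a time; for `n = 0` it
consists of the empty branch. -/
noncomputable def branchFinset : ℕ → Finset (ℕ → ℕ)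
  | 0 => {0}
  | n + 1 => ((branchFinset n).sigma fun i => range (ell n i 1 + 1)).image
      fun x => update x.1 (n + 1) (x.2 + 1)

theorem mem_branchFinset {n : ℕ} {i : ℕ → ℕ} :
    i ∈ branchFinset n ↔ (∀ τ < n, 1 ≤ i (τ + 1) ∧ i (τ + 1) ≤ 1 + ell τ i 1) ∧
      ∀ τ, τ = 0 ∨ n < τ → i τ = 0 := by
  induction n generalizing i with
  | zero =>
    simp only [branchFinset, mem_singleton, not_lt_zero, false_imp_iff, implies_true, true_and]
    exact ⟨by rintro rfl; simp, fun h => funext fun τ => h τ (by omega)⟩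
  | succ n ih =>
    simp only [branchFinset, mem_image, mem_sigma, mem_range, Sigma.exists]
    constructor
    · rintro ⟨i, c, ⟨hi, hc⟩, rfl⟩
      obtain ⟨h1, h2⟩ := ih.1 hi
      refine ⟨fun τ hτ => ?_, fun τ hτ => ?_⟩
      · rw [ell_congr (i' := i) fun σ hσ => update_of_ne (by omega) _ _]
        rcases Nat.lt_succ_iff_lt_or_eq.1 hτ with h | rfl
        · rw [update_of_ne (by omega)]
          exact h1 τ h
        · rw [update_self]
          omega
      · rw [update_of_ne (by omega)]
        exact h2 τ (by omega)
    · rintro ⟨h1, h2⟩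
      have hell (τ : ℕ) (hτ : τ ≤ n) : ell τ (update i (n + 1) 0) 1 = ell τ i 1 :=
        ell_congr (fun σ hσ => update_of_ne (by omega) _ _) 1
      have hn := h1 n (by omega)
      refine ⟨update i (n + 1) 0, i (n + 1) - 1, ⟨ih.2 ⟨fun τ hτ => ?_, fun τ hτ => ?_⟩, ?_⟩, ?_⟩
      · rw [hell τ (by omega), update_of_ne (by omega)]
        exact h1 τ (by omega)
      · by_cases h : τ = n + 1
        · simp [h]
        · rw [update_of_ne h]
          exact h2 τ (by omega)
      · rw [hell n le_rfl]
        omega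
      · rw [update_idem, Nat.sub_add_cancel hn.1, update_eq_self]

theorem isBranch_iff_mem_branchFinset {n : ℕ} (hn : 1 ≤ n) {i : ℕ → ℕ} :
    IsBranch n i ↔ i ∈ branchFinset n := by
  rw [mem_branchFinset, IsBranch]
  simp only [← ell_one]
  constructor
  · rintro ⟨h1, h2, h3, h4⟩
    refine ⟨fun τ hτ => ⟨h2 _ (by omega) (by omega), ?_⟩, h4⟩
    rcases Nat.eq_zero_or_pos τ with rfl | h
    · simp [h1]
    · exact h3 τ h hτ
  · rintro ⟨h1, h2⟩
    refine ⟨?_, fun τ hτ hτ' => ?_, fun τ _ hτ => (h1 τ hτ).2, h2⟩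
    · have := h1 0 hn
      have h0 := ell_one_le 0 i
      simp only [zero_add] at this
      omega
    · obtain ⟨τ, rfl⟩ := Nat.exists_eq_add_of_le' hτ
      exact (h1 τ (by omega)).1

/-- A branch has an entry `1` in first place, so the other values occur at most `n - 1` times. -/
theorem ell_le_of_mem_branchFinset {n : ℕ} (hn : 1 ≤ n) {i : ℕ → ℕ} (hi : i ∈ branchFinset n)
    {r : ℕ} (hr : 2 ≤ r) : ell n i r ≤ n := by
  have h1 : i 1 = 1 := ((isBranch_iff_mem_branchFinset hn).2 hi).1
  have : {τ ∈ Icc 1 n | i τ = r} ⊆ Icc 2 n := by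
    intro τ hτ
    simp only [mem_filter, mem_Icc] at hτ ⊢
    have : τ ≠ 1 := by
      rintro rfl
      omega
    omega
  have := card_le_card this
  rw [Nat.card_Icc] at this
  rw [ell, if_neg (by omega)]
  omega

theorem one_le_ell_one_of_mem_branchFinset {n : ℕ} (hn : 1 ≤ n) {i : ℕ → ℕ}
    (hi : i ∈ branchFinset n) : 1 ≤ ell n i 1 := by
  have h1 : i 1 = 1 := ((isBranch_iff_mem_branchFinset hn).2 hi).1
  rw [ell_one, Nat.one_le_iff_ne_zero, ← pos_iff_ne_zero, card_pos]
  exact ⟨1, by simp [h1, hn]⟩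

/-- Values beyond the admissible ones do not occur in a branch. -/
theorem ell_eq_one_of_mem_branchFinset {n : ℕ} {i : ℕ → ℕ} (hi : i ∈ branchFinset n) :
    ell n i (ell n i 1 + 2) = 1 := by
  rw [ell, if_neg (by omega), Nat.add_eq_left, card_eq_zero, filter_eq_empty_iff]
  intro τ hτ h
  obtain ⟨τ, rfl⟩ := Nat.exists_eq_add_of_le' (mem_Icc.1 hτ).1
  have hτ' := (mem_Icc.1 hτ).2
  have := ((mem_branchFinset.1 hi).1 τ (by omega)).2
  have := ell_one_mono (show τ ≤ n by omega) i
  omega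

open Classical in
theorem sum_branchFinset_succ {M : Type*} [AddCommMonoid M] (n : ℕ) (φ : (ℕ → ℕ) → M) :
    ∑ i ∈ branchFinset (n + 1), φ i =
      ∑ i ∈ branchFinset n, ∑ c ∈ range (ell n i 1 + 1), φ (update i (n + 1) (c + 1)) := by
  rw [branchFinset, sum_image, sum_sigma]
  rintro ⟨i, c⟩ hx ⟨i', c'⟩ hx' h
  simp only [coe_sigma, Set.mem_sigma_iff, mem_coe] at hx hx' h
  have hc : c = c' := by simpa using congrFun h (n + 1)
  subst hc
  have hi : i = i' := by
    funext τ
    by_cases hτ : τ = n + 1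
    · rw [hτ, (mem_branchFinset.1 hx.1).2 _ (by omega), (mem_branchFinset.1 hx'.1).2 _ (by omega)]
    · simpa [hτ] using congrFun h τ
  subst hi
  rfl

end Branches

section ChainRule

variable {E : Type*} [NormedAddCommGroup E] [NormedSpace ℝ E]

/-- Tree-indexed chain rule. -/
theorem iteratedDeriv_comp_eq_sum_branchFinset {h : E → ℝ} {H : ℝ → E} {N n : ℕ}
    (hh : ContDiff ℝ N h) (hH : ContDiff ℝ N H) (hn : n ≤ N) (s : ℝ) :
    iteratedDeriv n (fun s => h (H s)) s =
      ∑ i ∈ branchFinset n, iteratedFDeriv ℝ (ell n i 1) h (H s)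
        (fun j : Fin (ell n i 1) => iteratedDeriv (ell n i (j + 2)) H s) := by
  have hterm (s : ℝ) {k k' : ℕ} {a a' : ℕ → ℕ} (hk : k = k') (ha : ∀ j < k, a j = a' j) :
      iteratedFDeriv ℝ k h (H s) (fun j : Fin k => iteratedDeriv (a j) H s) =
        iteratedFDeriv ℝ k' h (H s) (fun j : Fin k' => iteratedDeriv (a' j) H s) := by
    subst hk
    congr 1
    ext j
    rw [ha j j.2]
  induction n generalizing s with
  | zero =>
    simpa [branchFinset] using hterm s (k := 0) (a := fun _ => 0) (show 0 = ell 0 0 1 by simp [ell])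
      (a' := fun j => ell 0 0 (j + 2)) (by simp)
  | succ n ih =>
    rw [iteratedDeriv_succ, funext (ih (by omega)), sum_branchFinset_succ]
    refine (HasDerivAt.fun_sum fun i hi => ?_).deriv
    have hle := ell_one_le n i
    refine (hasDerivAt_iteratedFDeriv_iteratedDeriv (fun j => ell n i (j + 2))
      (hh.of_le (by norm_cast; omega)) hH (by omega) (fun j hj => ?_) s).congr_deriv ?_
    · exact (ell_le_of_mem_branchFinset (by omega) hi (by omega)).trans_lt hn
    · rw [Finset.sum_range_succ']
      congr 1
      · refine Finset.sum_congr rfl fun c _ => ?_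
        refine hterm s (a := fun j => ell n i (j + 2) + if j = c then 1 else 0)
          (a' := fun j => ell (n + 1) (Function.update i (n + 1) (c + 1 + 1)) (j + 2)) ?_ ?_
        · simp [ell_update]
        · intro j _
          simp [ell_update, eq_comm]
      · refine hterm s (a := fun j => if j = ell n i 1 then 1 else ell n i (j + 2))
          (a' := fun j => ell (n + 1) (Function.update i (n + 1) (0 + 1)) (j + 2)) ?_ ?_
        · simp [ell_update]
        · intro j _
          simp only [ell_update]
          split_ifs with hj
          · omega
          · rw [hj, ell_eq_one_of_mem_branchFinset hi]
          · omega
          · rfl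

theorem iteratedFDeriv_fst_mul_snd_eq_sum_Icc {f : E → ℝ} {k : ℕ} (hk : 1 ≤ k)
    (hf : ContDiff ℝ k f) (z : E × ℝ) (v : ℕ → E × ℝ) :
    iteratedFDeriv ℝ k (fun z : E × ℝ => f z.1 * z.2) z (fun j : Fin k => v j) =
      z.2 * iteratedFDeriv ℝ k f z.1 (fun j : Fin k => (v j).1) +
        ∑ r ∈ Finset.Icc 2 (k + 1), (v (r - 2)).2 * iteratedFDeriv ℝ (k - 1) f z.1
          (fun j : Fin (k - 1) => (v (if (j : ℕ) + 2 < r then (j : ℕ) else j + 1)).1) := by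
  obtain ⟨k, rfl⟩ := Nat.exists_eq_add_of_le' hk
  rw [iteratedFDeriv_fst_mul_snd k hf, ← Finset.Ico_add_one_right_eq_Icc,
    Finset.sum_Ico_eq_sum_range, Finset.sum_range]
  congr 1
  refine Finset.sum_congr rfl fun r _ => ?_
  have (j : Fin k) : ((r.succAbove j : Fin (k + 1)) : ℕ) =
      if (j : ℕ) + 2 < 2 + r then (j : ℕ) else j + 1 := by
    simp only [Fin.succAbove, Fin.lt_def, Fin.val_castSucc]
    split_ifs <;> first | rfl | omega
  simp only [this, Nat.add_sub_cancel_left]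
  rfl

theorem iteratedDeriv_prodMk {F : ℝ → E} {G : ℝ → ℝ} {N n : ℕ} (hF : ContDiff ℝ N F)
    (hG : ContDiff ℝ N G) (hn : n ≤ N) (s : ℝ) :
    iteratedDeriv n (fun s => (F s, G s)) s = (iteratedDeriv n F s, iteratedDeriv n G s) := by
  simp only [iteratedDeriv_eq_iteratedFDeriv]
  rw [iteratedFDeriv_prodMk hF.contDiffAt hG.contDiffAt (by exact_mod_cast hn)]
  rfl

end ChainRule

/-- **Tree-indexed product differentiation rule** (formula (3.5) of Lemma 3.6, directional
form): if `f, g : ℝ^m → ℝ` and `F : ℝ → ℝ^m` are `N` times continuously differentiable, then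
the `N`-th derivative of `t ↦ f(F t)·g(F t)` equals `M_1(N) + M_2(N)`, where
`M_1(N) = ∑_{i ∈ A_N} g(F t) · ∂^{ℓ_1^i} f(F t)[F^{(ℓ_2^i)}(t), …, F^{(ℓ_{α_i}^i)}(t)]` and
`M_2(N) = ∑_{i ∈ A_N} ∑_{r=2}^{α_i} (g ∘ F)^{(ℓ_r^i)}(t) ·
∂^{ℓ_1^i−1} f(F t)[F^{(ℓ_2^i)}(t), …, F^{(ℓ_{r−1}^i)}(t), F^{(ℓ_{r+1}^i)}(t), …, F^{(ℓ_{α_i}^i)}(t)]`;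
in the `r`-th term of `M_2(N)` the argument `F^{(ℓ_r^i)}(t)` is removed, the remaining
`α_i − 2 = ℓ_1^i − 1` vectors (the `j`-th being `F^{(ℓ_q^i)}(t)` with `q = j+2` if `j+2 < r`
and `q = j+3` otherwise) are the arguments of `∂^{ℓ_1^i−1} f(F t)`, and the whole is
multiplied by the `ℓ_r^i`-th derivative of `g ∘ F` at `t`. -/
theorem tree_product_rule (N m : ℕ) (hN : 1 ≤ N)
    (f g : (Fin m → ℝ) → ℝ) (F : ℝ → Fin m → ℝ)
    (hf : ContDiff ℝ N f) (hg : ContDiff ℝ N g) (hF : ContDiff ℝ N F) (t : ℝ) :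
    iteratedDeriv N (fun s => f (F s) * g (F s)) t =
      (∑ᶠ i ∈ {i : ℕ → ℕ | IsBranch N i},
        g (F t) *
          iteratedFDeriv ℝ (ell N i 1) f (F t)
            (fun j : Fin (ell N i 1) => iteratedDeriv (ell N i ((j : ℕ) + 2)) F t)) +
      ∑ᶠ i ∈ {i : ℕ → ℕ | IsBranch N i},
        ∑ r ∈ Finset.Icc 2 (alpha N i),
          iteratedDeriv (ell N i r) (fun s => g (F s)) t *
            iteratedFDeriv ℝ (ell N i 1 - 1) f (F t)
              (fun j : Fin (ell N i 1 - 1) =>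
                iteratedDeriv
                  (ell N i (if (j : ℕ) + 2 < r then (j : ℕ) + 2 else (j : ℕ) + 3)) F t) := by
  have hH : ContDiff ℝ N (fun s => (F s, g (F s))) := hF.prodMk (hg.comp hF)
  have hh : ContDiff ℝ N (fun z : (Fin m → ℝ) × ℝ => f z.1 * z.2) :=
    (hf.comp contDiff_fst).mul contDiff_snd
  have hset : {i : ℕ → ℕ | IsBranch N i} = branchFinset N :=
    Set.ext fun i => isBranch_iff_mem_branchFinset hN
  have key := iteratedDeriv_comp_eq_sum_branchFinset hh hH le_rfl t
  rw [hset, finsum_mem_coe_finset, finsum_mem_coe_finset, ← Finset.sum_add_distrib]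
  refine key.trans (Finset.sum_congr rfl fun i hi => ?_)
  have hD (r : ℕ) (hr : 2 ≤ r) := iteratedDeriv_prodMk hF (hg.comp hF)
    (ell_le_of_mem_branchFinset hN hi hr) t
  simp only [Function.comp_def] at hD
  rw [iteratedFDeriv_fst_mul_snd_eq_sum_Icc (one_le_ell_one_of_mem_branchFinset hN hi)
    (hf.of_le (by exact_mod_cast ell_one_le N i)) (F t, g (F t))
    (fun j => iteratedDeriv (ell N i (j + 2)) (fun s => (F s, g (F s))) t), alpha]
  congr 1
  · simp only [hD _ (Nat.le_add_left 2 _)]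
  · refine Finset.sum_congr rfl fun r hr => ?_
    have hr2 := (Finset.mem_Icc.1 hr).1
    simp only [hD _ (Nat.le_add_left 2 _), Nat.sub_add_cancel hr2]
    congr 2
    · rw [hD r hr2]
    · funext j
      split_ifs <;> rfl
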